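/- arXiv:2305.05157 — 2 statements merged into one kernel-verified Lean document; each statement's English description precedes it below -/
import Mathlib

section
/- Let C be a linear [n,k] code over F_q and let J ⊆ {1,...,n} be a subset of coordinates. Let C_J be the projection of C onto the coordinates in J (the set of restrictions of codewords of C to the coordinates in J), and let C_0 be the code of length n − |J| obtained by taking all codewords of C that are zero on every coordinate of J and restricting them to the complement of J. Then the covering radii satisfy R_1(C) ≤ R_1(C_J) + R_1(C_0); that is, every v ∈ F_q^n is within Hamming distance R_1(C_J) + R_1(C_0) of some codeword of C. -/
/-- The covering radius of a linear code `C ⊆ F^ι`: the minimal `r` such that every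
vector is within Hamming distance `r` of some codeword. -/
noncomputable def covRad (F : Type*) [Field F] [DecidableEq F] {ι : Type*} [Fintype ι]
    (C : Submodule F (ι → F)) : ℕ :=
  sInf { r | ∀ v : ι → F, ∃ c ∈ C, hammingDist v c ≤ r }

theorem exists_hammingDist_le_covRad {F : Type*} [Field F] [DecidableEq F] {ι : Type*} [Fintype ι]
    (C : Submodule F (ι → F)) (v : ι → F) : ∃ c ∈ C, hammingDist v c ≤ covRad F C := by
  have h : { r | ∀ v : ι → F, ∃ c ∈ C, hammingDist v c ≤ r }.Nonempty :=
    ⟨Fintype.card ι, fun _ => ⟨0, C.zero_mem, hammingDist_le_card_fintype⟩⟩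
  exact Nat.sInf_mem h v

theorem covRad_le {F : Type*} [Field F] [DecidableEq F] {ι : Type*} [Fintype ι]
    {C : Submodule F (ι → F)} {r : ℕ} (h : ∀ v : ι → F, ∃ c ∈ C, hammingDist v c ≤ r) :
    covRad F C ≤ r :=
  Nat.sInf_le h

theorem hammingDist_subtype_add_hammingDist_subtype {α ι : Type*} [DecidableEq α] [Fintype ι]
    (p : ι → Prop) [Fintype { i // p i }] [Fintype { i // ¬ p i }] (x y : ι → α) :
    hammingDist (fun i : { i // p i } => x i) (fun i => y i) +
      hammingDist (fun i : { i // ¬ p i } => x i) (fun i => y i) = hammingDist x y := by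
  classical
  simp only [hammingDist, Finset.card_filter]
  convert Fintype.sum_subtype_add_sum_subtype p (fun i => if x i ≠ y i then 1 else 0)

/-- Let `C` be an `[n,k]` code over `F_q` and `J` a set of coordinates. Let `C_J` be the
projection of `C` onto the coordinates in `J`, and let `C_0` be the restriction to the
complement of `J` of the subcode of codewords vanishing on `J`. Then
`R_1(C) ≤ R_1(C_J) + R_1(C_0)`; that is, every vector is within Hamming distance
`R_1(C_J) + R_1(C_0)` of some codeword of `C`. -/
theorem stmt3 {F : Type*} [Field F] [Fintype F] [DecidableEq F] {q n k : ℕ}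
    (hq : Fintype.card F = q)
    (C : Submodule F (Fin n → F)) (hdim : Module.finrank F C = k)
    (J : Finset (Fin n))
    (CJ : Submodule F ({ j : Fin n // j ∈ J } → F))
    (hCJ : CJ = Submodule.map
      (LinearMap.funLeft F F (Subtype.val : { j : Fin n // j ∈ J } → Fin n)) C)
    (C0 : Submodule F ({ j : Fin n // j ∉ J } → F))
    (hC0 : C0 = Submodule.map
      (LinearMap.funLeft F F (Subtype.val : { j : Fin n // j ∉ J } → Fin n))
      (C ⊓ LinearMap.ker
        (LinearMap.funLeft F F (Subtype.val : { j : Fin n // j ∈ J } → Fin n)))) :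
    covRad F C ≤ covRad F CJ + covRad F C0 ∧
    ∀ v : Fin n → F, ∃ c ∈ C, hammingDist v c ≤ covRad F CJ + covRad F C0 := by
  have key : ∀ v : Fin n → F, ∃ c ∈ C, hammingDist v c ≤ covRad F CJ + covRad F C0 := by
    intro v
    obtain ⟨a, ha, hva⟩ := exists_hammingDist_le_covRad CJ (fun j => v j)
    rw [hCJ] at ha
    obtain ⟨c, hc, rfl⟩ := ha
    obtain ⟨b, hb, hvb⟩ := exists_hammingDist_le_covRad C0 (fun j => v j - c j)
    rw [hC0] at hb
    obtain ⟨d, ⟨hd, hdJ⟩, rfl⟩ := hb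
    refine ⟨c + d, C.add_mem hc hd, ?_⟩
    rw [← hammingDist_subtype_add_hammingDist_subtype (· ∈ J)]
    refine add_le_add (le_of_eq_of_le ?_ hva) (le_of_eq_of_le ?_ hvb)
    · congr 1
      funext j
      have hj : d j = 0 := congrFun (LinearMap.mem_ker.mp hdJ) j
      simp [LinearMap.funLeft_apply, hj]
    · simp only [hammingDist, LinearMap.funLeft_apply, Pi.add_apply, ne_eq, sub_eq_iff_eq_add']
  exact ⟨covRad_le key, key⟩
end

section
/- Let q be a prime power and let m ≥ 1 and 0 ≤ r ≤ (q−1)m be integers. Then the q-ary Reed–Muller code RM_q(r,m) satisfies the chain condition: letting k denote its dimension, there exist k linearly independent codewords c_1, ..., c_k of RM_q(r,m) such that |∪_{i=1}^{s} supp(c_i)| = d_s(RM_q(r,m)) for every s ∈ {1,...,k}, where d_s denotes the s-th generalized Hamming weight. -/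
/-- Evaluation of a multivariate polynomial at all points, as a linear map. -/
noncomputable def evalLM (F : Type*) [CommSemiring F] (m : ℕ) :
    MvPolynomial (Fin m) F →ₗ[F] ((Fin m → F) → F) where
  toFun f := fun x => MvPolynomial.eval x f
  map_add' f g := by funext x; simp
  map_smul' c f := by funext x; simp [MvPolynomial.smul_eval]

/-- The `q`-ary Reed–Muller code `RM_q(r,m)`: evaluation vectors of polynomials in `m`
variables of total degree at most `r` in which every variable has degree less than
`q = |F|` (i.e. at most `q − 1`). -/
noncomputable def qRM (F : Type*) [Field F] [Fintype F] (r m : ℕ) :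
    Submodule F ((Fin m → F) → F) :=
  Submodule.map (evalLM F m)
    (MvPolynomial.restrictTotalDegree (Fin m) F r ⊓
      MvPolynomial.restrictDegree (Fin m) F (Fintype.card F - 1))

/-- The `r`-th generalized Hamming weight of a linear code: the minimal support size
of an `r`-dimensional subcode. -/
noncomputable def GHW (F : Type*) [Field F] {ι : Type*} (C : Submodule F (ι → F))
    (r : ℕ) : ℕ :=
  sInf { w | ∃ D : Submodule F (ι → F), D ≤ C ∧ Module.finrank F D = r ∧
    { i | ∃ x ∈ D, x i ≠ 0 }.ncard = w }

/-! ### Digit sums and digitwise down-closed sets -/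

/-- The sum of the lowest `m` base-`q` digits of `x`. -/
def digSum (q m x : ℕ) : ℕ := ∑ i ∈ Finset.range m, x / q ^ i % q

/-- Digitwise comparison of the lowest `m` base-`q` digits. -/
def DigLE (q m y x : ℕ) : Prop := ∀ i < m, y / q ^ i % q ≤ x / q ^ i % q

/-- A set of `m`-digit numbers closed under decreasing digits. -/
def IsDigDown (q m : ℕ) (E : Finset ℕ) : Prop :=
  E ⊆ Finset.range (q ^ m) ∧ ∀ x ∈ E, ∀ y < q ^ m, DigLE q m y x → y ∈ E

/-- The number of elements of `E` of digit sum at least `t`. -/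
def tailCount (q m t : ℕ) (E : Finset ℕ) : ℕ := (E.filter fun x => t ≤ digSum q m x).card

/-- Splitting `(m+1)`-digit numbers into one digit and the `m` remaining digits. -/
structure Slicing (q m : ℕ) where
  /-- The number with the given distinguished digit and remaining digits. -/
  glue : ℕ → ℕ → ℕ
  lt : ∀ {j k}, j < q → k < q ^ m → glue j k < q ^ (m + 1)
  surj : ∀ {x}, x < q ^ (m + 1) → ∃ j < q, ∃ k < q ^ m, glue j k = x
  inj : ∀ {j k j' k'}, j < q → k < q ^ m → j' < q → k' < q ^ m →
    glue j k = glue j' k' → j = j' ∧ k = k'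
  strictMono : ∀ j, StrictMono (glue j)
  digSum_glue : ∀ {j k}, j < q → k < q ^ m → digSum q (m + 1) (glue j k) = j + digSum q m k
  digLE_glue : ∀ {j k j' k'}, j < q → k < q ^ m → j' < q → k' < q ^ m →
    (DigLE q (m + 1) (glue j' k') (glue j k) ↔ j' ≤ j ∧ DigLE q m k' k)

lemma digit_top_of_lt {q m i : ℕ} (hi : i < m) (j k : ℕ) :
    (j * q ^ m + k) / q ^ i % q = k / q ^ i % q := by
  rcases Nat.eq_zero_or_pos q with rfl | hq
  · simp [show m ≠ 0 by omega]
  obtain ⟨d, rfl⟩ := Nat.exists_eq_add_of_lt hi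
  have : j * q ^ (i + d + 1) + k = k + q ^ i * (q * (j * q ^ d)) := by ring
  rw [this, Nat.add_mul_div_left _ _ (by positivity), Nat.add_mul_mod_self_left]

lemma digit_top {q m j k : ℕ} (hj : j < q) (hk : k < q ^ m) :
    (j * q ^ m + k) / q ^ m % q = j := by
  have h : j * q ^ m + k = k + q ^ m * j := by ring
  rw [h, Nat.add_mul_div_left _ _ (by omega), Nat.div_eq_of_lt hk, zero_add, Nat.mod_eq_of_lt hj]

lemma digit_bot_succ {q j : ℕ} (hj : j < q) (i k : ℕ) :
    (k * q + j) / q ^ (i + 1) % q = k / q ^ i % q := by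
  rw [pow_succ', ← Nat.div_div_eq_div_mul, mul_comm k q, Nat.mul_add_div (by omega),
    Nat.div_eq_of_lt hj, add_zero]

lemma digit_bot {q j : ℕ} (hj : j < q) (k : ℕ) : (k * q + j) / q ^ 0 % q = j := by
  simp [Nat.mod_eq_of_lt hj]

/-- Splitting off the most significant digit. -/
def topSlicing (q m : ℕ) : Slicing q m where
  glue j k := j * q ^ m + k
  lt {j k} hj hk := by
    have : (j + 1) * q ^ m ≤ q * q ^ m := Nat.mul_le_mul_right _ hj
    rw [pow_succ']; nlinarith
  surj {x} hx := by
    have h0 : 0 < q ^ m := by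
      rcases Nat.eq_zero_or_pos (q ^ m) with h | h
      · simp [pow_succ, h] at hx
      · exact h
    refine ⟨x / q ^ m, ?_, x % q ^ m, Nat.mod_lt _ h0, Nat.div_add_mod' x _⟩
    rw [Nat.div_lt_iff_lt_mul h0]; rwa [pow_succ'] at hx
  inj {j k j' k'} hj hk hj' hk' h := by
    have h1 := digit_top hj hk
    rw [h, digit_top hj' hk'] at h1
    subst h1
    exact ⟨rfl, by simpa using h⟩
  strictMono j := fun a b h => by simpa using h
  digSum_glue {j k} hj hk := by
    rw [digSum, Finset.sum_range_succ, digit_top hj hk, add_comm, digSum]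
    congr 1
    exact Finset.sum_congr rfl fun i hi => digit_top_of_lt (Finset.mem_range.1 hi) _ _
  digLE_glue {j k j' k'} hj hk hj' hk' := by
    constructor
    · intro h
      refine ⟨by simpa [digit_top hj hk, digit_top hj' hk'] using h m (by omega), fun i hi => ?_⟩
      simpa [digit_top_of_lt hi] using h i (by omega)
    · rintro ⟨h1, h2⟩ i hi
      rcases Nat.lt_succ_iff_lt_or_eq.1 hi with hi | rfl
      · simpa [digit_top_of_lt hi] using h2 i hi
      · simpa [digit_top hj hk, digit_top hj' hk'] using h1

/-- Splitting off the least significant digit. -/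
def botSlicing (q m : ℕ) (hq : 0 < q) : Slicing q m where
  glue j k := k * q + j
  lt {j k} hj hk := by
    have : (k + 1) * q ≤ q ^ m * q := Nat.mul_le_mul_right _ hk
    rw [pow_succ]; nlinarith
  surj {x} hx := by
    refine ⟨x % q, Nat.mod_lt _ hq, x / q, ?_, Nat.div_add_mod' x _⟩
    rw [Nat.div_lt_iff_lt_mul hq]; rwa [pow_succ] at hx
  inj {j k j' k'} hj hk hj' hk' h := by
    have h1 := digit_bot hj k
    rw [h, digit_bot hj' k'] at h1
    subst h1
    exact ⟨rfl, Nat.eq_of_mul_eq_mul_right hq (by simpa using h)⟩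
  strictMono j := fun a b h => by
    have := Nat.mul_lt_mul_of_pos_right h hq
    simpa using this
  digSum_glue {j k} hj hk := by
    rw [digSum, Finset.sum_range_succ', digit_bot hj, add_comm, digSum]
    congr 1
    exact Finset.sum_congr rfl fun i hi => digit_bot_succ hj _ _
  digLE_glue {j k j' k'} hj hk hj' hk' := by
    constructor
    · intro h
      refine ⟨by simpa only [digit_bot hj, digit_bot hj'] using h 0 (by omega), fun i hi => ?_⟩
      simpa only [digit_bot_succ hj, digit_bot_succ hj'] using h (i + 1) (by omega)
    · rintro ⟨h1, h2⟩ i hi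
      rcases i with _ | i
      · simpa only [digit_bot hj, digit_bot hj'] using h1
      · simpa only [digit_bot_succ hj, digit_bot_succ hj'] using h2 i (by omega)

namespace Slicing

variable {q m : ℕ} (σ : Slicing q m)

/-- The slice of `E` at the distinguished digit `j`. -/
def slice (E : Finset ℕ) (j : ℕ) : Finset ℕ :=
  (Finset.range (q ^ m)).filter fun k => σ.glue j k ∈ E

/-- The set with prescribed slices. -/
def ofSlices (A : ℕ → Finset ℕ) : Finset ℕ :=
  (Finset.range q).biUnion fun j => (A j).image (σ.glue j)

lemma mem_slice {E : Finset ℕ} {j k : ℕ} : k ∈ σ.slice E j ↔ k < q ^ m ∧ σ.glue j k ∈ E := by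
  simp [slice]

lemma mem_ofSlices {A : ℕ → Finset ℕ} {x : ℕ} :
    x ∈ σ.ofSlices A ↔ ∃ j < q, ∃ k ∈ A j, σ.glue j k = x := by
  simp [ofSlices]

lemma ofSlices_slice {E : Finset ℕ} (hE : E ⊆ Finset.range (q ^ (m + 1))) :
    σ.ofSlices (σ.slice E) = E := by
  ext x
  rw [mem_ofSlices]
  constructor
  · rintro ⟨j, -, k, hk, rfl⟩
    exact (σ.mem_slice.1 hk).2
  · intro hx
    obtain ⟨j, hj, k, hk, rfl⟩ := σ.surj (Finset.mem_range.1 (hE hx))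
    exact ⟨j, hj, k, σ.mem_slice.2 ⟨hk, hx⟩, rfl⟩

lemma sum_ofSlices {A : ℕ → Finset ℕ} (hA : ∀ j < q, A j ⊆ Finset.range (q ^ m)) (h : ℕ → ℕ) :
    ∑ x ∈ σ.ofSlices A, h x = ∑ j ∈ Finset.range q, ∑ k ∈ A j, h (σ.glue j k) := by
  rw [ofSlices, Finset.sum_biUnion]
  · refine Finset.sum_congr rfl fun j _ => ?_
    exact Finset.sum_image fun a _ b _ hab => (σ.strictMono j).injective hab
  · intro j hj j' hj' hne
    simp only [Finset.coe_range, Set.mem_Iio] at hj hj'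
    refine Finset.disjoint_left.2 fun x hx hx' => hne ?_
    obtain ⟨k, hk, rfl⟩ := Finset.mem_image.1 hx
    obtain ⟨k', hk', he⟩ := Finset.mem_image.1 hx'
    exact (σ.inj hj (Finset.mem_range.1 (hA j hj hk)) hj' (Finset.mem_range.1 (hA j' hj' hk'))
      he.symm).1

lemma card_ofSlices {A : ℕ → Finset ℕ} (hA : ∀ j < q, A j ⊆ Finset.range (q ^ m)) :
    (σ.ofSlices A).card = ∑ j ∈ Finset.range q, (A j).card := by
  simpa using σ.sum_ofSlices hA fun _ => 1

lemma tailCount_ofSlices {A : ℕ → Finset ℕ} (hA : ∀ j < q, A j ⊆ Finset.range (q ^ m)) (t : ℕ) :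
    tailCount q (m + 1) t (σ.ofSlices A) =
      ∑ j ∈ Finset.range q, tailCount q m (t - j) (A j) := by
  simp only [tailCount, Finset.card_filter]
  rw [σ.sum_ofSlices hA]
  refine Finset.sum_congr rfl fun j hj => Finset.sum_congr rfl fun k hk => ?_
  rw [σ.digSum_glue (Finset.mem_range.1 hj)
    (Finset.mem_range.1 (hA j (Finset.mem_range.1 hj) hk))]
  simp only [Nat.sub_le_iff_le_add']

lemma isDigDown_slice {E : Finset ℕ} (hE : IsDigDown q (m + 1) E) {j : ℕ} (hj : j < q) :
    IsDigDown q m (σ.slice E j) := by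
  refine ⟨Finset.filter_subset _ _, fun x hx y hy hyx => ?_⟩
  rw [mem_slice] at hx ⊢
  exact ⟨hy, hE.2 _ hx.2 _ (σ.lt hj hy) ((σ.digLE_glue hj hx.1 hj hy).2 ⟨le_rfl, hyx⟩)⟩

lemma slice_anti {E : Finset ℕ} (hE : IsDigDown q (m + 1) E) {j j' : ℕ} (hj : j' < q)
    (h : j ≤ j') : σ.slice E j' ⊆ σ.slice E j := by
  intro x hx
  rw [mem_slice] at hx ⊢
  exact ⟨hx.1, hE.2 _ hx.2 _ (σ.lt (by omega) hx.1)
    ((σ.digLE_glue hj hx.1 (by omega) hx.1).2 ⟨h, fun _ _ => le_rfl⟩)⟩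

end Slicing

lemma DigLE.le {q m x y : ℕ} (hx : x < q ^ m) (hy : y < q ^ m) (h : DigLE q m y x) : y ≤ x := by
  induction m generalizing x y with
  | zero => simp at hx hy; omega
  | succ m ih =>
    obtain ⟨j, hj, k, hk, rfl⟩ := (topSlicing q m).surj hx
    obtain ⟨j', hj', k', hk', rfl⟩ := (topSlicing q m).surj hy
    obtain ⟨h1, h2⟩ := ((topSlicing q m).digLE_glue hj hk hj' hk').1 h
    exact Nat.add_le_add (Nat.mul_le_mul_right _ h1) (ih hk hk' h2)

lemma Slicing.isDigDown_ofSlices_range {q m : ℕ} (σ : Slicing q m) {n : ℕ → ℕ}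
    (hn : ∀ j < q, n j ≤ q ^ m) (hanti : ∀ j j', j ≤ j' → j' < q → n j' ≤ n j) :
    IsDigDown q (m + 1) (σ.ofSlices fun j => Finset.range (n j)) := by
  constructor
  · intro x hx
    obtain ⟨j, hj, k, hk, rfl⟩ := σ.mem_ofSlices.1 hx
    exact Finset.mem_range.2 (σ.lt hj ((Finset.mem_range.1 hk).trans_le (hn j hj)))
  · intro x hx y hy hyx
    obtain ⟨j, hj, k, hk, rfl⟩ := σ.mem_ofSlices.1 hx
    obtain ⟨j', hj', k', hk', rfl⟩ := σ.surj hy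
    rw [Finset.mem_range] at hk
    have hkm := hk.trans_le (hn j hj)
    obtain ⟨h1, h2⟩ := (σ.digLE_glue hj hkm hj' hk').1 hyx
    refine σ.mem_ofSlices.2 ⟨j', hj', k', Finset.mem_range.2 ?_, rfl⟩
    exact ((h2.le hkm hk').trans_lt hk).trans_le (hanti _ _ h1 hj)

lemma card_sdiff_range_card (E : Finset ℕ) :
    (E \ Finset.range E.card).card = (Finset.range E.card \ E).card := by
  have h1 := Finset.card_sdiff_add_card_inter E (Finset.range E.card)
  have h2 := Finset.card_sdiff_add_card_inter (Finset.range E.card) E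
  rw [Finset.inter_comm, Finset.card_range] at h2
  omega

lemma sum_range_card_lt {E : Finset ℕ} {h : ℕ → ℕ} (hh : StrictMono h)
    (hE : E ≠ Finset.range E.card) : ∑ k ∈ Finset.range E.card, h k < ∑ k ∈ E, h k := by
  set n := E.card with hn
  have hc := card_sdiff_range_card E
  rw [← hn] at hc
  have hne : (Finset.range n \ E).Nonempty := by
    rw [Finset.sdiff_nonempty]
    intro hsub
    exact hE (Finset.eq_of_subset_of_card_le hsub (by simp [hn])).symm
  have h1 := Finset.sum_inter_add_sum_sdiff E (Finset.range n) h
  have h2 := Finset.sum_inter_add_sum_sdiff (Finset.range n) E h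
  rw [Finset.inter_comm] at h2
  have h3 : ∑ k ∈ Finset.range n \ E, h k < (Finset.range n \ E).card • h n :=
    (Finset.sum_lt_sum_of_nonempty hne fun k hk => hh (by simp at hk; exact hk.1)).trans_eq
      (Finset.sum_const _)
  have h4 : (E \ Finset.range n).card • h n ≤ ∑ k ∈ E \ Finset.range n, h k :=
    Finset.card_nsmul_le_sum _ _ _ fun k hk => hh.monotone (by simp at hk; exact hk.2)
  rw [hc] at h4
  omega

/-- If exchanging an element for a smaller missing one never lowers the digit sum, the initial
segment has the largest tail counts. -/
lemma tailCount_le_of_exchange {q m : ℕ} {E : Finset ℕ}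
    (h : ∀ x y, x ∉ E → y ∈ E → x < y → digSum q m y ≤ digSum q m x) (t : ℕ) :
    tailCount q m t E ≤ tailCount q m t (Finset.range E.card) := by
  set n := E.card with hn
  have hc := card_sdiff_range_card E
  rw [← hn] at hc
  have h1 := Finset.sum_inter_add_sum_sdiff E (Finset.range n)
    fun x => if t ≤ digSum q m x then 1 else 0
  have h2 := Finset.sum_inter_add_sum_sdiff (Finset.range n) E
    fun x => if t ≤ digSum q m x then 1 else 0
  rw [Finset.inter_comm] at h2
  simp only [tailCount, Finset.card_filter]
  suffices hs : ∑ x ∈ E \ Finset.range n, (if t ≤ digSum q m x then 1 else 0) ≤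
      ∑ x ∈ Finset.range n \ E, (if t ≤ digSum q m x then 1 else 0) by omega
  by_cases hy : ∃ y ∈ E \ Finset.range n, t ≤ digSum q m y
  · obtain ⟨y, hy, hty⟩ := hy
    have hall : ∀ x ∈ Finset.range n \ E, t ≤ digSum q m x := by
      intro x hx
      simp at hx hy
      exact hty.trans (h x y hx.2 hy.1 (by omega))
    rw [Finset.sum_congr rfl fun x hx => if_pos (hall x hx), ← Finset.card_eq_sum_ones, ← hc,
      ← Finset.card_filter]
    exact Finset.card_filter_le _ _
  · push Not at hy
    rw [Finset.sum_congr rfl fun x hx => if_neg (not_le.2 (hy x hx))]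
    simp

/-! ### Two digits: compression of antidiagonals -/

section Antidiagonal

open Classical in
/-- The first coordinates of the points of `D` on the antidiagonal of level `u`. -/
noncomputable def antidiag (q : ℕ) (D : ℕ → ℕ → Prop) (u : ℕ) : Finset ℕ :=
  (Finset.range q).filter fun i => i ≤ u ∧ D i (u - i)

variable {q : ℕ} {D : ℕ → ℕ → Prop}

lemma mem_antidiag {u i : ℕ} : i ∈ antidiag q D u ↔ i < q ∧ i ≤ u ∧ D i (u - i) := by
  simp [antidiag]

lemma card_antidiag_of_ge (hD : ∀ i v, D i v → i < q ∧ v < q)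
    (hdown : ∀ i v i' v', i' ≤ i → v' ≤ v → D i v → D i' v') {u : ℕ} (hu : q ≤ u)
    (hne : (antidiag q D u).Nonempty) :
    (antidiag q D u).card + 1 ≤ (antidiag q D (u - 1)).card := by
  have hmin := Finset.min'_mem _ hne
  set i₀ := (antidiag q D u).min' hne with hi₀
  have hmem := mem_antidiag.1 hmin
  have h1 := hD _ _ hmem.2.2
  have hnot : i₀ - 1 ∉ antidiag q D u := fun h => by
    have := Finset.min'_le _ _ h
    omega
  rw [← Finset.card_insert_of_notMem hnot]
  refine Finset.card_le_card fun i hi => ?_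
  rw [mem_antidiag]
  rcases Finset.mem_insert.1 hi with rfl | hi
  · exact ⟨by omega, by omega, hdown _ _ _ _ (by omega) (by omega) hmem.2.2⟩
  · have h2 := mem_antidiag.1 hi
    have h3 := hD _ _ h2.2.2
    exact ⟨by omega, by omega, hdown _ _ _ _ le_rfl (by omega) h2.2.2⟩

lemma min_card_antidiag_le (hdown : ∀ i v i' v', i' ≤ i → v' ≤ v → D i v → D i' v') (u : ℕ) :
    min (antidiag q D u).card u ≤ (antidiag q D (u - 1)).card := by
  by_cases hfull : ∃ j ≤ u, j ∉ antidiag q D u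
  · obtain ⟨j, hj, hjn⟩ := hfull
    refine (min_le_left _ _).trans ?_
    have hinj : Set.InjOn (fun i => if i < j then i else i - 1) (antidiag q D u : Set ℕ) := by
      intro a ha b hb hab
      have ha' : a ≠ j := fun h => hjn (h ▸ ha)
      have hb' : b ≠ j := fun h => hjn (h ▸ hb)
      simp only at hab
      split_ifs at hab <;> omega
    rw [← Finset.card_image_of_injOn hinj]
    refine Finset.card_le_card fun i hi => ?_
    obtain ⟨a, ha, rfl⟩ := Finset.mem_image.1 hi
    have ha' : a ≠ j := fun h => hjn (h ▸ ha)
    have h2 := mem_antidiag.1 ha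
    simp only [mem_antidiag]
    split_ifs with haj
    · exact ⟨by omega, by omega, hdown _ _ _ _ le_rfl (by omega) h2.2.2⟩
    · exact ⟨by omega, by omega, hdown _ _ _ _ (by omega) (by omega) h2.2.2⟩
  · push Not at hfull
    refine (min_le_right _ _).trans ?_
    rw [← Finset.card_range u]
    refine Finset.card_le_card fun i hi => ?_
    rw [Finset.card_range, Finset.mem_range] at *
    have h2 := mem_antidiag.1 (hfull i (by omega))
    exact mem_antidiag.2 ⟨by omega, by omega, hdown _ _ _ _ le_rfl (by omega) h2.2.2⟩

/-- Push the points of `D` on each antidiagonal to the smallest first coordinates. -/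
def pushed (q : ℕ) (D : ℕ → ℕ → Prop) (i v : ℕ) : Prop :=
  i < q ∧ v < q ∧ i < (i + v - (q - 1)) + (antidiag q D (i + v)).card

lemma pushed_down (hD : ∀ i v, D i v → i < q ∧ v < q)
    (hdown : ∀ i v i' v', i' ≤ i → v' ≤ v → D i v → D i' v') (i v i' v' : ℕ) (hi : i' ≤ i)
    (hv : v' ≤ v) (h : pushed q D i v) : pushed q D i' v' := by
  have key : ∀ i v, pushed q D i v → 1 ≤ i + v →
      i < (i + v - 1 - (q - 1)) + (antidiag q D (i + v - 1)).card + (if 1 ≤ v then 0 else 1) := by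
    rintro i v ⟨h1, h2, h3⟩ h4
    rcases lt_or_ge (i + v) q with hu | hu
    · have := min_card_antidiag_le (q := q) hdown (i + v)
      split_ifs <;> omega
    · have := card_antidiag_of_ge hD hdown hu (Finset.card_pos.1 (by omega))
      split_ifs <;> omega
  have h1 : pushed q D i v' := by
    induction v, hv using Nat.le_induction with
    | base => exact h
    | succ n hn ih =>
      refine ih ⟨h.1, by have := h.2.1; omega, ?_⟩
      simpa using key _ _ h (by omega)
  clear h
  induction i, hi using Nat.le_induction with
  | base => exact h1
  | succ n hn ih =>
    refine ih ⟨by have := h1.1; omega, h1.2.1, ?_⟩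
    have := key _ _ h1 (by omega)
    rw [show n + 1 + v' - 1 = n + v' by omega] at this
    split_ifs at this <;> omega

lemma card_antidiag_pushed (hq : 0 < q) (hD : ∀ i v, D i v → i < q ∧ v < q) (u : ℕ) :
    (antidiag q (pushed q D) u).card = (antidiag q D u).card := by
  have hle : (antidiag q D u).card ≤ (Finset.Ico (u - (q - 1)) (min u (q - 1) + 1)).card := by
    refine Finset.card_le_card fun i hi => ?_
    have h2 := mem_antidiag.1 hi
    have := hD _ _ h2.2.2
    rw [Finset.mem_Ico]
    omega
  rw [Nat.card_Ico] at hle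
  have : antidiag q (pushed q D) u =
      Finset.Ico (u - (q - 1)) (u - (q - 1) + (antidiag q D u).card) := by
    ext i
    rw [mem_antidiag, Finset.mem_Ico]
    constructor
    · rintro ⟨h1, h2, h3, h4, h5⟩
      rw [Nat.add_sub_cancel' h2] at h5
      omega
    · rintro ⟨h1, h2⟩
      have hiu : i ≤ u := by omega
      refine ⟨by omega, hiu, by omega, by omega, ?_⟩
      rwa [Nat.add_sub_cancel' hiu]
  rw [this, Nat.card_Ico]
  omega

end Antidiagonal

lemma digSum_one {q v : ℕ} (hv : v < q) : digSum q 1 v = v := by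
  simp [digSum, Nat.mod_eq_of_lt hv]

lemma digLE_one {q v v' : ℕ} (hv : v < q) (hv' : v' < q) : DigLE q 1 v' v ↔ v' ≤ v := by
  simp [DigLE, Nat.mod_eq_of_lt hv, Nat.mod_eq_of_lt hv']

lemma card_level_eq {q u : ℕ} {E : Finset ℕ} (hE : E ⊆ Finset.range (q ^ 2)) :
    (E.filter fun x => digSum q 2 x = u).card =
      (antidiag q (fun i v => i < q ∧ v < q ∧ i * q + v ∈ E) u).card := by
  symm
  refine Finset.card_bij (fun i _ => i * q + (u - i)) ?_ ?_ ?_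
  · intro i hi
    obtain ⟨h1, h2, h3, h4, h5⟩ := mem_antidiag.1 hi
    refine Finset.mem_filter.2 ⟨h5, ?_⟩
    have := (topSlicing q 1).digSum_glue (j := i) (k := u - i) h1 (by simpa using h4)
    simp only [topSlicing, pow_one, digSum_one h4] at this
    rw [this]; omega
  · intro i hi j hj hij
    obtain ⟨h1, h2, h3, h4, h5⟩ := mem_antidiag.1 hi
    obtain ⟨h1', h2', h3', h4', h5'⟩ := mem_antidiag.1 hj
    exact ((topSlicing q 1).inj h1 (by simpa using h4) h1' (by simpa using h4')
      (by simpa [topSlicing] using hij)).1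
  · intro x hx
    obtain ⟨h1, h2⟩ := Finset.mem_filter.1 hx
    obtain ⟨i, hi, v, hv, rfl⟩ := (topSlicing q 1).surj (Finset.mem_range.1 (hE h1))
    rw [(topSlicing q 1).digSum_glue hi hv] at h2
    rw [pow_one] at hv
    rw [digSum_one hv] at h2
    simp only [topSlicing, pow_one] at h1 ⊢
    have huv : u - i = v := by omega
    refine ⟨i, mem_antidiag.2 ⟨hi, by omega, hi, ?_⟩, by rw [huv]⟩
    rw [huv]
    exact ⟨hv, h1⟩

lemma tailCount_eq_sum {q m t B : ℕ} {E : Finset ℕ} (hB : ∀ x ∈ E, digSum q m x < B) :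
    tailCount q m t E = ∑ u ∈ Finset.range B,
      if t ≤ u then (E.filter fun x => digSum q m x = u).card else 0 := by
  rw [tailCount, Finset.card_filter, ← Finset.sum_fiberwise_of_maps_to
    (g := digSum q m) (t := Finset.range B) fun x hx => Finset.mem_range.2 (hB x hx)]
  refine Finset.sum_congr rfl fun u _ => ?_
  rw [Finset.sum_congr rfl (g := fun _ => if t ≤ u then 1 else 0) fun x hx => by
    rw [(Finset.mem_filter.1 hx).2]]
  split_ifs <;> simp

lemma tailCount_zero (q m : ℕ) (E : Finset ℕ) : tailCount q m 0 E = E.card := by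
  simp [tailCount]

lemma digSum_le {q m : ℕ} (hq : 0 < q) (x : ℕ) : digSum q m x ≤ (q - 1) * m := by
  rw [digSum, mul_comm]
  refine (Finset.sum_le_card_nsmul _ _ (q - 1) fun i _ => ?_).trans (by simp)
  have := Nat.mod_lt (x / q ^ i) hq
  omega

lemma tailCount_le_two {q : ℕ} (hq : 0 < q) {E : Finset ℕ} (hE : IsDigDown q 2 E) (t : ℕ) :
    tailCount q 2 t E ≤ tailCount q 2 t (Finset.range E.card) := by
  classical
  set D : ℕ → ℕ → Prop := fun i v => i < q ∧ v < q ∧ i * q + v ∈ E with hDdef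
  have hD : ∀ i v, D i v → i < q ∧ v < q := fun i v h => ⟨h.1, h.2.1⟩
  have hdown : ∀ i v i' v', i' ≤ i → v' ≤ v → D i v → D i' v' := by
    rintro i v i' v' hi hv ⟨h1, h2, h3⟩
    have hi' : i' < q := by omega
    have hv' : v' < q := by omega
    have key := (topSlicing q 1).digLE_glue (k := v) (k' := v') h1 (by simpa using h2) hi'
      (by simpa using hv')
    have hlt := (topSlicing q 1).lt (k := v') hi' (by simpa using hv')
    simp only [topSlicing, pow_one] at key hlt
    exact ⟨hi', hv', hE.2 _ h3 _ hlt (key.2 ⟨hi, (digLE_one h2 hv').2 hv⟩)⟩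
  have hdown' := pushed_down hD hdown
  set E' : Finset ℕ := (Finset.range (q ^ 2)).filter fun x => pushed q D (x / q) (x % q) with hE'
  have hmem : ∀ i v, i < q → v < q → (i * q + v ∈ E' ↔ pushed q D i v) := by
    intro i v hi hv
    have hlt := (topSlicing q 1).lt (k := v) hi (by simpa using hv)
    simp only [topSlicing, pow_one] at hlt
    rw [hE', Finset.mem_filter, Finset.mem_range, mul_comm i q, Nat.mul_add_div hq,
      Nat.div_eq_of_lt hv, Nat.mul_add_mod, Nat.mod_eq_of_lt hv, add_zero, mul_comm q i]
    simp only [hlt, true_and]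
  have hEsub : E' ⊆ Finset.range (q ^ 2) := Finset.filter_subset _ _
  have hlev : ∀ u, (E'.filter fun x => digSum q 2 x = u).card =
      (E.filter fun x => digSum q 2 x = u).card := by
    intro u
    rw [card_level_eq hE.1, card_level_eq hEsub, ← hDdef, ← card_antidiag_pushed hq hD]
    congr 1
    ext i
    simp only [mem_antidiag]
    refine and_congr_right fun h1 => and_congr_right fun h2 => ?_
    constructor
    · rintro ⟨h3, h4, h5⟩
      exact (hmem _ _ h3 h4).1 h5
    · intro h
      exact ⟨h.1, h.2.1, (hmem _ _ h.1 h.2.1).2 h⟩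
  have hcnt : ∀ t, tailCount q 2 t E' = tailCount q 2 t E := by
    intro t
    have hB : ∀ x, digSum q 2 x < (q - 1) * 2 + 1 := fun x => Nat.lt_succ_of_le (digSum_le hq x)
    rw [tailCount_eq_sum fun x _ => hB x, tailCount_eq_sum fun x _ => hB x]
    simp only [hlev]
  have hcard : E'.card = E.card := by simpa only [tailCount_zero] using hcnt 0
  rw [← hcnt, ← hcard]
  refine tailCount_le_of_exchange (fun x y hx hy hxy => ?_) t
  have hy2 := Finset.mem_range.1 (hEsub hy)
  obtain ⟨c, hc, d, hd, rfl⟩ := (topSlicing q 1).surj hy2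
  obtain ⟨a, ha, b, hb, rfl⟩ := (topSlicing q 1).surj (hxy.trans hy2)
  rw [(topSlicing q 1).digSum_glue hc hd, (topSlicing q 1).digSum_glue ha hb]
  simp only [topSlicing, pow_one] at *
  rw [digSum_one hd, digSum_one hb]
  rw [hmem _ _ ha hb] at hx
  rw [hmem _ _ hc hd] at hy
  by_contra! hlt
  have hac : a ≤ c := by
    by_contra! hca
    have : (c + 1) * q ≤ a * q := Nat.mul_le_mul_right _ hca
    rw [add_mul] at this
    omega
  obtain ⟨-, -, h3⟩ := hy
  by_cases hw : c + d - a ≤ q - 1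
  · refine hx (hdown' a (c + d - a) _ _ le_rfl (by omega) ⟨ha, by omega, ?_⟩)
    rw [show a + (c + d - a) = c + d by omega]
    omega
  · refine hx (hdown' (c + d - (q - 1)) (q - 1) _ _ (by omega) (by omega)
      ⟨by omega, by omega, ?_⟩)
    rw [show c + d - (q - 1) + (q - 1) = c + d by omega]
    omega

/-! ### Compression of slices -/

namespace Slicing

variable {q m : ℕ} (σ : Slicing q m)

/-- Replace every slice by the initial segment of the same size. -/
def compress (E : Finset ℕ) : Finset ℕ :=
  σ.ofSlices fun j => Finset.range (σ.slice E j).card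

lemma slice_subset (E : Finset ℕ) (j : ℕ) : σ.slice E j ⊆ Finset.range (q ^ m) :=
  Finset.filter_subset _ _

lemma card_slice_le (E : Finset ℕ) (j : ℕ) : (σ.slice E j).card ≤ q ^ m := by
  simpa using Finset.card_le_card (σ.slice_subset E j)

lemma isDigDown_compress {E : Finset ℕ} (hE : IsDigDown q (m + 1) E) :
    IsDigDown q (m + 1) (σ.compress E) :=
  σ.isDigDown_ofSlices_range (fun j _ => σ.card_slice_le E j)
    fun _ _ h hj => Finset.card_le_card (σ.slice_anti hE hj h)

lemma card_compress {E : Finset ℕ} (hE : IsDigDown q (m + 1) E) :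
    (σ.compress E).card = E.card := by
  conv_rhs => rw [← σ.ofSlices_slice hE.1]
  rw [compress, σ.card_ofSlices fun j _ => Finset.range_subset_range.2 (σ.card_slice_le E j),
    σ.card_ofSlices fun j _ => σ.slice_subset E j]
  simp

lemma tailCount_le_compress {E : Finset ℕ} (hE : IsDigDown q (m + 1) E)
    (ih : ∀ A, IsDigDown q m A → ∀ t,
      tailCount q m t A ≤ tailCount q m t (Finset.range A.card)) (t : ℕ) :
    tailCount q (m + 1) t E ≤ tailCount q (m + 1) t (σ.compress E) := by
  conv_lhs => rw [← σ.ofSlices_slice hE.1]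
  rw [compress, σ.tailCount_ofSlices fun j _ => Finset.range_subset_range.2 (σ.card_slice_le E j),
    σ.tailCount_ofSlices fun j _ => σ.slice_subset E j]
  exact Finset.sum_le_sum fun j hj =>
    ih _ (σ.isDigDown_slice hE (Finset.mem_range.1 hj)) _

lemma sum_compress_lt {E : Finset ℕ} (hE : IsDigDown q (m + 1) E) {j : ℕ} (hj : j < q)
    (hne : σ.slice E j ≠ Finset.range (σ.slice E j).card) :
    ∑ x ∈ σ.compress E, x < ∑ x ∈ E, x := by
  conv_rhs => rw [← σ.ofSlices_slice hE.1]
  rw [compress, σ.sum_ofSlices fun j _ => Finset.range_subset_range.2 (σ.card_slice_le E j),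
    σ.sum_ofSlices fun j _ => σ.slice_subset E j]
  refine Finset.sum_lt_sum (fun i _ => ?_)
    ⟨j, Finset.mem_range.2 hj, sum_range_card_lt (σ.strictMono j) hne⟩
  by_cases h : σ.slice E i = Finset.range (σ.slice E i).card
  · exact le_of_eq (by rw [← h])
  · exact (sum_range_card_lt (σ.strictMono i) h).le

/-- If all slices are initial segments, `E` is closed under decreasing within a slice. -/
lemma mem_of_slice_eq_range {E : Finset ℕ}
    (h : ∀ j < q, σ.slice E j = Finset.range (σ.slice E j).card) {j k k' : ℕ} (hj : j < q)
    (hk : k < q ^ m) (hkk : k' ≤ k) (hmem : σ.glue j k ∈ E) : σ.glue j k' ∈ E := by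
  have h1 : k ∈ σ.slice E j := σ.mem_slice.2 ⟨hk, hmem⟩
  rw [h j hj, Finset.mem_range] at h1
  have h2 : k' ∈ Finset.range (σ.slice E j).card := Finset.mem_range.2 (by omega)
  rw [← h j hj] at h2
  exact (σ.mem_slice.1 h2).2

end Slicing

lemma digSum_exchange_of_slices {q m : ℕ} (hq : 2 ≤ q) {E : Finset ℕ}
    (hE : E ⊆ Finset.range (q ^ (m + 3)))
    (htop : ∀ j < q, (topSlicing q (m + 2)).slice E j =
      Finset.range ((topSlicing q (m + 2)).slice E j).card)
    (hbot : ∀ j < q, (botSlicing q (m + 2) (by omega)).slice E j =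
      Finset.range ((botSlicing q (m + 2) (by omega)).slice E j).card)
    {x y : ℕ} (hx : x ∉ E) (hy : y ∈ E) (hxy : x < y) :
    digSum q (m + 3) y ≤ digSum q (m + 3) x := by
  have hq0 : 0 < q := by omega
  set R := q ^ (m + 1) with hR
  have hP : q ^ (m + 2) = R * q := pow_succ q (m + 1)
  have hR2 : 2 ≤ R := hq.trans (Nat.le_self_pow (by omega) q)
  have hylt := Finset.mem_range.1 (hE hy)
  have T : ∀ {a k k'}, a < q → k < R * q → k' ≤ k → a * (R * q) + k ∈ E →
      a * (R * q) + k' ∈ E := by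
    intro a k k' ha hk hkk h
    have := (topSlicing q (m + 2)).mem_of_slice_eq_range htop ha (by rwa [hP]) hkk
    simp only [topSlicing, hP] at this
    exact this h
  have B : ∀ {c k k'}, c < q → k' ≤ k → k * q + c ∈ E → k' * q + c ∈ E := by
    intro c k k' hc hkk h
    refine (botSlicing q (m + 2) hq0).mem_of_slice_eq_range hbot hc ?_ hkk h
    have := Finset.mem_range.1 (hE h)
    rw [pow_succ] at this
    by_contra! hcon
    have := Nat.mul_le_mul_right q hcon
    omega
  obtain ⟨b, hb, l, hl, rfl⟩ := (topSlicing q (m + 2)).surj hylt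
  obtain ⟨a, ha, k, hk, rfl⟩ := (topSlicing q (m + 2)).surj (hxy.trans hylt)
  rw [(topSlicing q (m + 2)).digSum_glue hb hl, (topSlicing q (m + 2)).digSum_glue ha hk]
  obtain ⟨c, hc, k₁, hk₁, rfl⟩ := (botSlicing q (m + 1) hq0).surj hk
  obtain ⟨d, hd, l₁, hl₁, rfl⟩ := (botSlicing q (m + 1) hq0).surj hl
  rw [(botSlicing q (m + 1) hq0).digSum_glue hc hk₁,
    (botSlicing q (m + 1) hq0).digSum_glue hd hl₁]
  rw [← hR] at hk₁ hl₁
  simp only [topSlicing, botSlicing, hP] at hx hy hxy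
  have regroup : ∀ a k c, a * (R * q) + (k * q + c) = (a * R + k) * q + c := by
    intro a k c; ring
  have B' : ∀ {a k a' k' c}, c < q → a' * R + k' ≤ a * R + k → a * (R * q) + (k * q + c) ∈ E →
      a' * (R * q) + (k' * q + c) ∈ E := by
    intro a k a' k' c hc hle h
    rw [regroup] at h ⊢
    exact B hc hle h
  have hlast : ∀ {c : ℕ}, c < q → (R - 1) * q + c < R * q := by
    intro c hc
    have : R * q = (R - 1) * q + q := by
      conv_lhs => rw [show R = R - 1 + 1 by omega, add_mul, one_mul]
    omega
  have hRq : q ≤ (R - 1) * q := Nat.le_mul_of_pos_left _ (by omega)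
  rw [hP] at hk hl
  simp only [botSlicing] at hk hl
  have hab : a < b := by
    by_contra! hba
    rcases hba.lt_or_eq with hba | rfl
    · have : (b + 1) * (R * q) ≤ a * (R * q) := Nat.mul_le_mul_right _ hba
      rw [add_mul] at this
      omega
    · exact hx (T hb hl (by omega) hy)
  have hab' : (a + 1) * R ≤ b * R := Nat.mul_le_mul_right _ hab
  rw [add_mul, one_mul] at hab'
  have h1 : (R - 1) * q + d < k₁ * q + c := by
    by_contra! hle
    exact hx (T ha (hlast hd) hle (B' hd (by omega) hy))
  have hk₁' : k₁ = R - 1 := by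
    by_contra hne
    have : (k₁ + 1) * q ≤ (R - 1) * q := Nat.mul_le_mul_right _ (by omega)
    rw [add_mul] at this
    omega
  subst hk₁'
  have hl₁' : l₁ = 0 := by
    by_contra hne
    have : q ≤ l₁ * q := Nat.le_mul_of_pos_left _ (by omega)
    have hmem : b * (R * q) + (0 * q + c) ∈ E := T hb hl (by omega) hy
    exact hx (B' hc (by omega) hmem)
  subst hl₁'
  have hba : b = a + 1 := by
    by_contra hne
    have h2 : (a + 1 + 1) * R ≤ b * R := Nat.mul_le_mul_right _ (by omega)
    rw [add_mul, one_mul] at h2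
    have hmem : (a + 1) * (R * q) + ((R - 1) * q + d) ∈ E := B' hd (by omega) hy
    have hmem' : (a + 1) * (R * q) + (0 * q + c) ∈ E := T (by omega) (hlast hd) (by omega) hmem
    refine hx (B' hc ?_ hmem')
    rw [add_mul]
    omega
  have h0 : digSum q (m + 1) 0 = 0 := by simp [digSum]
  omega

/-- Among digitwise down-closed sets of a given size, the initial segment has the most elements
of digit sum at least `t`. -/
theorem tailCount_le_range {q : ℕ} (hq : 2 ≤ q) (m : ℕ) (E : Finset ℕ) (hE : IsDigDown q m E)
    (t : ℕ) : tailCount q m t E ≤ tailCount q m t (Finset.range E.card) := by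
  match m with
  | 0 =>
    refine tailCount_le_of_exchange (fun x y _ hy hxy => ?_) t
    have := Finset.mem_range.1 (hE.1 hy)
    simp at this
    omega
  | 1 =>
    refine tailCount_le_of_exchange (fun x y hx hy hxy => (hx ?_).elim) t
    have hyq := Finset.mem_range.1 (hE.1 hy)
    have hxq := hxy.trans hyq
    refine hE.2 y hy x hxq ?_
    rw [pow_one] at hyq hxq
    exact (digLE_one hyq hxq).2 hxy.le
  | 2 => exact tailCount_le_two (by omega) hE t
  | m + 3 =>
    have ih := tailCount_le_range hq (m + 2)
    induction hs : ∑ x ∈ E, x using Nat.strong_induction_on generalizing E with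
    | _ s ihs =>
      have step : ∀ σ : Slicing q (m + 2),
          (¬ ∀ j < q, σ.slice E j = Finset.range (σ.slice E j).card) →
          tailCount q (m + 3) t E ≤ tailCount q (m + 3) t (Finset.range E.card) := by
        intro σ h
        push Not at h
        obtain ⟨j, hj, hne⟩ := h
        refine (σ.tailCount_le_compress hE ih t).trans ?_
        rw [← σ.card_compress hE]
        exact ihs _ (hs ▸ σ.sum_compress_lt hE hj hne) _ (σ.isDigDown_compress hE) rfl
      by_cases htop : ∀ j < q, (topSlicing q (m + 2)).slice E j =
          Finset.range ((topSlicing q (m + 2)).slice E j).card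
      · by_cases hbot : ∀ j < q, (botSlicing q (m + 2) (by omega)).slice E j =
            Finset.range ((botSlicing q (m + 2) (by omega)).slice E j).card
        · exact tailCount_le_of_exchange
            (fun x y hx hy hxy => digSum_exchange_of_slices hq hE.1 htop hbot hx hy hxy) t
        · exact step _ hbot
      · exact step _ htop

lemma sum_tailCount_range_le {q m : ℕ} (hq : 2 ≤ q) {n : ℕ → ℕ} (hn : ∀ j < q, n j ≤ q ^ m)
    (hanti : ∀ j j', j ≤ j' → j' < q → n j' ≤ n j) (t : ℕ) :
    ∑ j ∈ Finset.range q, tailCount q m (t - j) (Finset.range (n j)) ≤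
      tailCount q (m + 1) t (Finset.range (∑ j ∈ Finset.range q, n j)) := by
  have hsub : ∀ j < q, Finset.range (n j) ⊆ Finset.range (q ^ m) :=
    fun j hj => Finset.range_subset_range.2 (hn j hj)
  have h := tailCount_le_range hq (m + 1) _
    ((topSlicing q m).isDigDown_ofSlices_range hn hanti) t
  rw [(topSlicing q m).tailCount_ofSlices hsub, (topSlicing q m).card_ofSlices hsub] at h
  simpa only [Finset.card_range] using h

/-! ### Functions given by polynomials of bounded total degree -/

/-- The functions on `F^m` given by polynomials of total degree at most `r`. -/
noncomputable def degLE (F : Type*) [Field F] (r m : ℕ) : Submodule F ((Fin m → F) → F) :=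
  Submodule.map (evalLM F m) (MvPolynomial.restrictTotalDegree (Fin m) F r)

section DegLE

variable {F : Type*} [Field F] {m r s : ℕ}

lemma mem_degLE {f : (Fin m → F) → F} :
    f ∈ degLE F r m ↔ ∃ p : MvPolynomial (Fin m) F, p.totalDegree ≤ r ∧
      ∀ x, MvPolynomial.eval x p = f x := by
  simp [degLE, MvPolynomial.mem_restrictTotalDegree, evalLM, funext_iff]

lemma degLE_mono (h : r ≤ s) : degLE F r m ≤ degLE F s m := fun f hf => by
  obtain ⟨p, hp, hpf⟩ := mem_degLE.1 hf
  exact mem_degLE.2 ⟨p, hp.trans h, hpf⟩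

lemma mul_mem_degLE {f g : (Fin m → F) → F} (hf : f ∈ degLE F r m) (hg : g ∈ degLE F s m) :
    f * g ∈ degLE F (r + s) m := by
  obtain ⟨p, hp, hpf⟩ := mem_degLE.1 hf
  obtain ⟨p', hp', hpg⟩ := mem_degLE.1 hg
  exact mem_degLE.2 ⟨p * p', (MvPolynomial.totalDegree_mul _ _).trans (add_le_add hp hp'),
    fun x => by simp [hpf, hpg]⟩

lemma coord_pow_mem_degLE (i : Fin m) (k : ℕ) : (fun x : Fin m → F => x i ^ k) ∈ degLE F k m :=
  mem_degLE.2 ⟨MvPolynomial.X i ^ k, by simp [MvPolynomial.totalDegree_X_pow], fun x => by simp⟩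

lemma comp_tail_mem_degLE {f : (Fin m → F) → F} (hf : f ∈ degLE F r m) :
    (fun x => f (Fin.tail x)) ∈ degLE F r (m + 1) := by
  obtain ⟨p, hp, hpf⟩ := mem_degLE.1 hf
  refine mem_degLE.2 ⟨MvPolynomial.rename Fin.succ p,
    (MvPolynomial.totalDegree_rename_le _ _).trans hp, fun x => ?_⟩
  rw [MvPolynomial.eval_rename, ← hpf]
  rfl

lemma exists_coeff_of_mem_degLE {f : (Fin (m + 1) → F) → F} (hf : f ∈ degLE F r (m + 1)) :
    ∃ c : ℕ → (Fin m → F) → F, (∀ i ≤ r, c i ∈ degLE F (r - i) m) ∧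
      ∀ a y, f (Fin.cons a y) = ∑ i ∈ Finset.range (r + 1), a ^ i * c i y := by
  obtain ⟨p, hp, hpf⟩ := mem_degLE.1 hf
  refine ⟨fun i y => MvPolynomial.eval y ((MvPolynomial.finSuccEquiv F m p).coeff i),
    fun i hi => mem_degLE.2 ⟨_, ?_, fun _ => rfl⟩, fun a y => ?_⟩
  · by_cases h : (MvPolynomial.finSuccEquiv F m p).coeff i = 0
    · simp [h]
    · have := MvPolynomial.totalDegree_coeff_finSuccEquiv_add_le p i h
      omega
  · rw [← hpf, MvPolynomial.eval_eq_eval_mv_eval', Polynomial.eval_eq_sum_range' (n := r + 1)]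
    · simp [mul_comm]
    · refine Nat.lt_succ_of_le (Polynomial.natDegree_map_le.trans ?_)
      rw [MvPolynomial.natDegree_finSuccEquiv]
      exact (MvPolynomial.degreeOf_le_totalDegree _ _).trans hp

lemma restrict_mem_degLE {f : (Fin (m + 1) → F) → F} (hf : f ∈ degLE F r (m + 1)) (a : F) :
    (fun y => f (Fin.cons a y)) ∈ degLE F r m := by
  obtain ⟨c, hc, hfc⟩ := exists_coeff_of_mem_degLE hf
  have : (fun y => f (Fin.cons a y)) = ∑ i ∈ Finset.range (r + 1), a ^ i • c i := by
    ext y; simp [hfc]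
  rw [this]
  refine Submodule.sum_mem _ fun i hi => Submodule.smul_mem _ _ ?_
  exact degLE_mono (Nat.sub_le _ _) (hc i (by simpa [Nat.lt_succ_iff] using hi))

lemma eq_zero_or_exists_mul_of_vanishing {f : (Fin (m + 1) → F) → F}
    (hf : f ∈ degLE F r (m + 1)) {a : F} (h0 : ∀ y, f (Fin.cons a y) = 0) :
    f = 0 ∨ 1 ≤ r ∧ ∃ h ∈ degLE F (r - 1) (m + 1), ∀ x, f x = (x 0 - a) * h x := by
  obtain ⟨c, hc, hfc⟩ := exists_coeff_of_mem_degLE hf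
  rcases Nat.eq_zero_or_pos r with rfl | hr
  · left
    ext x
    rw [← Fin.cons_self_tail x, hfc]
    simpa [hfc] using h0 (Fin.tail x)
  right
  refine ⟨hr, fun x => ∑ i ∈ Finset.range (r + 1),
    (∑ l ∈ Finset.range i, x 0 ^ l * a ^ (i - 1 - l)) * c i (Fin.tail x), ?_, fun x => ?_⟩
  · have : (fun x : Fin (m + 1) → F => ∑ i ∈ Finset.range (r + 1),
        (∑ l ∈ Finset.range i, x 0 ^ l * a ^ (i - 1 - l)) * c i (Fin.tail x)) =
        ∑ i ∈ Finset.range (r + 1), ∑ l ∈ Finset.range i, a ^ (i - 1 - l) •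
          ((fun x : Fin (m + 1) → F => x 0 ^ l) * fun x => c i (Fin.tail x)) := by
      ext x
      simp only [Finset.sum_apply, Pi.smul_apply, Pi.mul_apply, smul_eq_mul, Finset.sum_mul]
      exact Finset.sum_congr rfl fun i _ => Finset.sum_congr rfl fun l _ => by ring
    rw [this]
    refine Submodule.sum_mem _ fun i hi => Submodule.sum_mem _ fun l hl =>
      Submodule.smul_mem _ _ ?_
    rw [Finset.mem_range] at hi hl
    exact degLE_mono (by omega)
      (mul_mem_degLE (coord_pow_mem_degLE 0 l) (comp_tail_mem_degLE (hc i (by omega))))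
  · have h1 := hfc (x 0) (Fin.tail x)
    have h2 := hfc a (Fin.tail x)
    rw [h0] at h2
    rw [Fin.cons_self_tail] at h1
    rw [← sub_zero (f x), h1, h2, ← Finset.sum_sub_distrib, Finset.mul_sum]
    refine Finset.sum_congr rfl fun i _ => ?_
    rw [← sub_mul, ← geom_sum₂_mul]
    ring

lemma eq_zero_or_exists_prod_mul_of_vanishing {α : ℕ → F} {j : ℕ}
    (hα : Set.InjOn α (Set.Iio j)) {f : (Fin (m + 1) → F) → F} (hf : f ∈ degLE F r (m + 1))
    (h0 : ∀ i < j, ∀ y, f (Fin.cons (α i) y) = 0) :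
    f = 0 ∨ j ≤ r ∧ ∃ h ∈ degLE F (r - j) (m + 1),
      ∀ x, f x = (∏ i ∈ Finset.range j, (x 0 - α i)) * h x := by
  induction j with
  | zero => exact Or.inr ⟨Nat.zero_le _, f, hf, by simp⟩
  | succ j ih =>
    rcases ih (hα.mono fun x hx => Nat.lt_succ_of_lt hx) fun i hi => h0 i (by omega) with
      h | ⟨hj, h, hh, hfh⟩
    · exact Or.inl h
    · have hh0 : ∀ y, h (Fin.cons (α j) y) = 0 := by
        intro y
        have h1 := h0 j (by omega) y
        rw [hfh, mul_eq_zero, Finset.prod_eq_zero_iff] at h1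
        refine h1.resolve_left ?_
        rintro ⟨i, hi, h2⟩
        rw [Finset.mem_range] at hi
        have := hα (by simp : j ∈ Set.Iio (j + 1)) (by simp; omega : i ∈ Set.Iio (j + 1))
          (by simpa [sub_eq_zero] using h2)
        omega
      rcases eq_zero_or_exists_mul_of_vanishing hh hh0 with rfl | ⟨hr, g, hg, hhg⟩
      · left; ext x; simp [hfh]
      · refine Or.inr ⟨by omega, g, by rwa [Nat.sub_sub] at hg, fun x => ?_⟩
        rw [hfh, hhg, Finset.prod_range_succ, mul_assoc]

/-- Restriction of functions to the hyperplane where the first coordinate is `a`. -/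
def restrictFirst (m : ℕ) (a : F) : ((Fin (m + 1) → F) → F) →ₗ[F] ((Fin m → F) → F) where
  toFun f y := f (Fin.cons a y)
  map_add' _ _ := rfl
  map_smul' _ _ := rfl

lemma finrank_eq_map_add_inf_ker {V W : Type*} [AddCommGroup V] [Module F V] [AddCommGroup W]
    [Module F W] [FiniteDimensional F V] (D : Submodule F V) (φ : V →ₗ[F] W) :
    Module.finrank F D =
      Module.finrank F (D.map φ) + Module.finrank F ↥(D ⊓ LinearMap.ker φ) := by
  rw [← LinearMap.finrank_range_add_finrank_ker (φ.domRestrict D), LinearMap.range_domRestrict,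
    LinearMap.ker_domRestrict, ← Submodule.map_comap_subtype,
    LinearEquiv.finrank_eq (Submodule.equivMapOfInjective D.subtype D.injective_subtype _)]

end DegLE

open Classical in
/-- The part of `S` on the hyperplane where the first coordinate is `a`. -/
noncomputable def hyperSlice {F : Type*} [Fintype F] {m : ℕ} (S : Finset (Fin (m + 1) → F)) (a : F) :
    Finset (Fin m → F) :=
  Finset.univ.filter fun y => (Fin.cons a y : Fin (m + 1) → F) ∈ S

lemma mem_hyperSlice {F : Type*} [Fintype F] {m : ℕ} {S : Finset (Fin (m + 1) → F)} {a : F} {y : Fin m → F} :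
    y ∈ hyperSlice S a ↔ (Fin.cons a y : Fin (m + 1) → F) ∈ S := by
  simp [hyperSlice]

lemma sum_card_hyperSlice {F : Type*} [Fintype F] {m : ℕ} (S : Finset (Fin (m + 1) → F)) :
    ∑ a, (hyperSlice S a).card = S.card := by
  classical
  rw [← Finset.card_sigma]
  refine Finset.card_bij (fun x _ => (Fin.cons x.1 x.2 : Fin (m + 1) → F)) ?_ ?_ ?_
  · rintro ⟨a, y⟩ h
    simpa [mem_hyperSlice] using h
  · rintro ⟨a, y⟩ _ ⟨b, z⟩ _ h
    obtain ⟨rfl, rfl⟩ := Fin.cons_inj.1 h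
    rfl
  · intro x hx
    exact ⟨⟨x 0, Fin.tail x⟩, by simpa [mem_hyperSlice] using hx, by simp⟩

section FiniteField

variable {F : Type*} [Field F] [Fintype F]

lemma exists_monotone_enum (n : F → ℕ) : ∃ α : ℕ → F,
    Set.InjOn α (Set.Iio (Fintype.card F)) ∧ (∀ a, ∃ i < Fintype.card F, α i = a) ∧
      ∀ i j, i ≤ j → j < Fintype.card F → n (α i) ≤ n (α j) := by
  classical
  let e := (Fintype.equivFin F).symm
  let e' := (Tuple.sort (n ∘ e)).trans e
  refine ⟨fun i => if h : i < Fintype.card F then e' ⟨i, h⟩ else 0, ?_, fun a => ?_, ?_⟩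
  · intro i hi j hj hij
    simp only [Set.mem_Iio] at hi hj
    simpa [hi, hj] using hij
  · exact ⟨e'.symm a, (e'.symm a).2, by simp⟩
  · intro i j hij hj
    have := Tuple.monotone_sort (n ∘ e) (show (⟨i, by omega⟩ : Fin (Fintype.card F)) ≤ ⟨j, hj⟩
      from hij)
    simpa [hj, hij.trans_lt hj, e'] using this

/-- A space of functions of degree at most `r` supported on `n` points has dimension at most the
number of `x < n` of digit sum at least `(q - 1) m - r`. -/
theorem finrank_le_tailCount (m : ℕ) (S : Finset (Fin m → F)) (r : ℕ)
    (D : Submodule F ((Fin m → F) → F)) (hD : D ≤ degLE F r m)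
    (hS : ∀ f ∈ D, ∀ x ∉ S, f x = 0) :
    Module.finrank F D ≤ tailCount (Fintype.card F) m ((Fintype.card F - 1) * m - r)
      (Finset.range S.card) := by
  have hq : 2 ≤ Fintype.card F := Fintype.one_lt_card
  set q := Fintype.card F with hqdef
  induction m generalizing r with
  | zero =>
    rw [mul_zero, Nat.zero_sub, tailCount_zero, Finset.card_range]
    rcases S.eq_empty_or_nonempty with rfl | hne
    · have : D = ⊥ := (Submodule.eq_bot_iff _).2 fun f hf => funext fun x => hS f hf x (by simp)
      simp [this]
    · refine (Submodule.finrank_le D).trans ?_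
      simpa using hne
  | succ m ih =>
    obtain ⟨α, hinj, hsurj, hmono⟩ := exists_monotone_enum fun a => (hyperSlice S a).card
    rw [← hqdef] at hinj hsurj hmono
    set n : ℕ → ℕ := fun j => (hyperSlice S (α j)).card with hn
    set t := (q - 1) * (m + 1) - r with ht
    let V : ℕ → Submodule F ((Fin (m + 1) → F) → F) := fun j =>
      D ⊓ ⨅ i ∈ Finset.range j, LinearMap.ker (restrictFirst m (α i))
    have hV : ∀ {j f}, f ∈ V j ↔ f ∈ D ∧ ∀ i < j, ∀ y, f (Fin.cons (α i) y) = 0 := by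
      intro j f
      simp [V, Submodule.mem_iInf, restrictFirst, funext_iff]
    have hVsucc : ∀ j, V j ⊓ LinearMap.ker (restrictFirst m (α j)) = V (j + 1) := by
      intro j
      ext f
      simp only [Submodule.mem_inf, hV, LinearMap.mem_ker, Nat.lt_succ_iff_lt_or_eq]
      constructor
      · rintro ⟨⟨h1, h2⟩, h3⟩
        refine ⟨h1, fun i hi y => ?_⟩
        rcases hi with hi | rfl
        · exact h2 i hi y
        · exact congrFun h3 y
      · rintro ⟨h1, h2⟩
        exact ⟨⟨h1, fun i hi => h2 i (Or.inl hi)⟩, funext fun y => h2 j (Or.inr rfl) y⟩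
    have hstep : ∀ j < q, Module.finrank F (V j) ≤
        tailCount q m (t - (q - 1 - j)) (Finset.range (n j)) + Module.finrank F (V (j + 1)) := by
      intro j hj
      rw [finrank_eq_map_add_inf_ker (V j) (restrictFirst m (α j)), hVsucc]
      refine Nat.add_le_add_right ?_ _
      have hfac : ∀ f ∈ V j, _ := fun f hf => eq_zero_or_exists_prod_mul_of_vanishing
        (hinj.mono fun x hx => lt_trans hx hj) (hD (hV.1 hf).1) (hV.1 hf).2
      by_cases hjr : j ≤ r
      · have hexp : t - (q - 1 - j) = (q - 1) * m - (r - j) := by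
          rw [ht, mul_add, mul_one]; omega
        rw [hexp]
        refine ih _ _ _ ?_ ?_
        · rintro _ ⟨f, hf, rfl⟩
          rcases hfac f hf with rfl | ⟨-, h, hh, hfh⟩
          · simp
          · have : restrictFirst m (α j) f = (∏ i ∈ Finset.range j, (α j - α i)) •
                fun y => h (Fin.cons (α j) y) := by
              ext y
              simp [restrictFirst, hfh]
            rw [this]
            exact Submodule.smul_mem _ _ (restrict_mem_degLE hh _)
        · rintro _ ⟨f, hf, rfl⟩ y hy
          exact hS f (hV.1 hf).1 _ fun h => hy (mem_hyperSlice.2 h)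
      · have : V j = ⊥ := (Submodule.eq_bot_iff _).2 fun f hf =>
          (hfac f hf).resolve_right fun h => hjr h.1
        rw [this, Submodule.map_bot, finrank_bot]
        exact Nat.zero_le _
    have hsum : ∀ j ≤ q, Module.finrank F D ≤
        (∑ i ∈ Finset.range j, tailCount q m (t - (q - 1 - i)) (Finset.range (n i))) +
          Module.finrank F (V j) := by
      intro j hj
      induction j with
      | zero =>
        have hV0 : V 0 = D := by ext f; simp [hV]
        rw [hV0]
        simp
      | succ j ihj =>
        have h1 := ihj (by omega)
        have h2 := hstep j (by omega)
        rw [Finset.sum_range_succ]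
        omega
    have hVq : V q = ⊥ := by
      refine (Submodule.eq_bot_iff _).2 fun f hf => funext fun x => ?_
      obtain ⟨i, hi, hix⟩ := hsurj (x 0)
      rw [← Fin.cons_self_tail x, ← hix]
      exact (hV.1 hf).2 i hi _
    have hfin := hsum q le_rfl
    rw [hVq, finrank_bot, add_zero, ← Finset.sum_range_reflect] at hfin
    have hcongr : ∀ j ∈ Finset.range q, tailCount q m (t - (q - 1 - (q - 1 - j)))
        (Finset.range (n (q - 1 - j))) = tailCount q m (t - j) (Finset.range (n (q - 1 - j))) := by
      intro j hj
      rw [Finset.mem_range] at hj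
      rw [show q - 1 - (q - 1 - j) = j by omega]
    rw [Finset.sum_congr rfl hcongr] at hfin
    have hcard : ∑ j ∈ Finset.range q, n (q - 1 - j) = S.card := by
      rw [Finset.sum_range_reflect n q, ← sum_card_hyperSlice S]
      refine Finset.sum_bij (fun j _ => α j) (by simp) ?_ ?_ fun _ _ => rfl
      · intro i hi j hj h
        exact hinj (by simpa using hi) (by simpa using hj) h
      · intro a _
        obtain ⟨i, hi, h⟩ := hsurj a
        exact ⟨i, by simpa using hi, h⟩
    rw [← hcard]
    refine hfin.trans (sum_tailCount_range_le hq (fun j _ => ?_) (fun j j' h hj => ?_) t)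
    · refine (Finset.card_le_univ _).trans_eq ?_
      simp [hqdef]
    · exact hmono _ _ (by omega) (by omega)

end FiniteField

/-! ### Codewords with digitwise down-closed support -/

/-- The point whose coordinates are the `F`-labels of the base-`q` digits of `y`. -/
def digitPoint {F : Type*} (q m : ℕ) (α : ℕ → F) (y : ℕ) : Fin m → F := fun i => α (y / q ^ (i : ℕ) % q)

lemma exists_digitPoint_eq {F : Type*} {q m : ℕ} {α : ℕ → F} (hα : ∀ a, ∃ i < q, α i = a) (v : Fin m → F) :
    ∃ y < q ^ m, digitPoint q m α y = v := by
  choose d hd hdv using fun i => hα (v i)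
  refine ⟨finFunctionFinEquiv fun i => ⟨d i, hd i⟩, Fin.is_lt _, funext fun i => ?_⟩
  rw [digitPoint, ← finFunctionFinEquiv_symm_apply_val, Equiv.symm_apply_apply, hdv]

section Codewords

variable {F : Type*} [Field F] {q m r : ℕ} {α : ℕ → F}

/-- A product of linear factors not vanishing exactly at the points labelled by numbers
digitwise at most `x`. -/
noncomputable def digitPoly (q m : ℕ) (α : ℕ → F) (x : ℕ) : MvPolynomial (Fin m) F :=
  ∏ i : Fin m, ∏ j ∈ Finset.Ioo (x / q ^ (i : ℕ) % q) q, (MvPolynomial.X i - MvPolynomial.C (α j))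

lemma eval_digitPoly_ne_zero_iff (hq : 0 < q) (hα : Set.InjOn α (Set.Iio q)) {x y : ℕ} :
    MvPolynomial.eval (digitPoint q m α y) (digitPoly q m α x) ≠ 0 ↔ DigLE q m y x := by
  simp only [digitPoly, map_prod, map_sub, MvPolynomial.eval_X, MvPolynomial.eval_C,
    Finset.prod_ne_zero_iff, Finset.mem_univ, true_imp_iff, Finset.mem_Ioo, sub_ne_zero, digitPoint]
  constructor
  · intro h i hi
    by_contra! hlt
    exact h ⟨i, hi⟩ _ ⟨hlt, Nat.mod_lt _ hq⟩ rfl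
  · rintro h i j ⟨hj, hjq⟩ heq
    have := hα (Set.mem_Iio.2 (Nat.mod_lt _ hq)) (Set.mem_Iio.2 hjq) heq
    have := h i i.2
    omega

lemma totalDegree_digitPoly_add_le (hq : 0 < q) (x : ℕ) :
    (digitPoly q m α x).totalDegree + digSum q m x ≤ (q - 1) * m := by
  have h1 : (digitPoly q m α x).totalDegree ≤ ∑ i : Fin m, (q - 1 - x / q ^ (i : ℕ) % q) := by
    refine (MvPolynomial.totalDegree_finsetProd _ _).trans (Finset.sum_le_sum fun i _ => ?_)
    refine (MvPolynomial.totalDegree_finsetProd _ _).trans ?_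
    refine (Finset.sum_le_card_nsmul _ _ 1 fun j _ => ?_).trans ?_
    · refine (MvPolynomial.totalDegree_sub _ _).trans ?_
      simp
    · simp only [Nat.card_Ioo, smul_eq_mul, mul_one]; omega
  refine (Nat.add_le_add_right h1 _).trans ?_
  rw [digSum, ← Fin.sum_univ_eq_sum_range (fun i => x / q ^ i % q), ← Finset.sum_add_distrib]
  refine (Finset.sum_le_card_nsmul _ _ (q - 1) fun i _ => ?_).trans ?_
  · have := Nat.mod_lt (x / q ^ (i : ℕ)) hq
    omega
  · simp [mul_comm]

lemma degreeOf_digitPoly_le (x : ℕ) (i : Fin m) :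
    (digitPoly q m α x).degreeOf i ≤ q - 1 := by
  refine (MvPolynomial.degreeOf_prod_le _ _ _).trans ?_
  rw [Finset.sum_eq_single_of_mem i (Finset.mem_univ i)]
  · refine (MvPolynomial.degreeOf_prod_le _ _ _).trans ?_
    refine (Finset.sum_le_card_nsmul _ _ 1 fun j _ => ?_).trans ?_
    · refine (MvPolynomial.degreeOf_sub_le _ _ _).trans ?_
      simp
    · simp only [Nat.card_Ioo, smul_eq_mul, mul_one]; omega
  · intro l _ hl
    refine Nat.le_zero.1 ((MvPolynomial.degreeOf_prod_le _ _ _).trans ?_)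
    refine Finset.sum_nonpos fun j _ => (MvPolynomial.degreeOf_sub_le _ _ _).trans ?_
    simp [MvPolynomial.degreeOf_X, hl.symm]

lemma evalLM_digitPoly_mem_qRM [Fintype F] (hq : Fintype.card F = q) {x : ℕ}
    (hx : (q - 1) * m - r ≤ digSum q m x) : evalLM F m (digitPoly q m α x) ∈ qRM F r m := by
  refine Submodule.mem_map_of_mem ⟨?_, ?_⟩
  · rw [SetLike.mem_coe, MvPolynomial.mem_restrictTotalDegree]
    have := totalDegree_digitPoly_add_le (m := m) (α := α) (hq ▸ Fintype.card_pos) x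
    omega
  · rw [SetLike.mem_coe, MvPolynomial.mem_restrictDegree]
    intro s hs i
    rw [hq]
    exact (MvPolynomial.monomial_le_degreeOf i hs).trans (degreeOf_digitPoly_le x i)

end Codewords

lemma qRM_le_degLE (F : Type*) [Field F] [Fintype F] (r m : ℕ) : qRM F r m ≤ degLE F r m :=
  Submodule.map_mono inf_le_left

lemma linearIndependent_of_triangular {F ι : Type*} [Field F] {k : ℕ} (c : Fin k → ι → F)
    (p : Fin k → ι) (hdiag : ∀ i, c i (p i) ≠ 0) (hlt : ∀ i s, i < s → c i (p s) = 0) :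
    LinearIndependent F c := by
  rw [Fintype.linearIndependent_iff]
  intro g hg i
  induction i using WellFoundedGT.induction with
  | ind i ih =>
    have h := congrFun hg (p i)
    simp only [Finset.sum_apply, Pi.smul_apply, smul_eq_mul, Pi.zero_apply] at h
    rw [Finset.sum_eq_single_of_mem i (Finset.mem_univ i)] at h
    · exact (mul_eq_zero.1 h).resolve_right (hdiag i)
    · intro j _ hj
      rcases lt_or_gt_of_ne hj with hj | hj
      · rw [hlt j i hj, mul_zero]
      · rw [ih j hj, zero_mul]

/-- The numbers below `q ^ m` of digit sum at least `t`. -/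
def heavy (q m t : ℕ) : Finset ℕ := (Finset.range (q ^ m)).filter fun x => t ≤ digSum q m x

lemma tailCount_range_le_of_le_orderEmbOfFin {q m t k w : ℕ} (h : (heavy q m t).card = k)
    (s : Fin k) (hw : w ≤ (heavy q m t).orderEmbOfFin h s) :
    tailCount q m t (Finset.range w) ≤ s := by
  set e := (heavy q m t).orderEmbOfFin h
  have hlt : ∀ i, e i < q ^ m := fun i =>
    Finset.mem_range.1 (Finset.mem_filter.1 ((heavy q m t).orderEmbOfFin_mem h i)).1
  have hsub : ((Finset.range w).filter fun x => t ≤ digSum q m x) ⊆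
      (Finset.Iio s).image e := by
    intro x hx
    simp only [Finset.mem_filter, Finset.mem_range] at hx
    have hmem : x ∈ heavy q m t := by
      simp only [heavy, Finset.mem_filter, Finset.mem_range]
      exact ⟨hx.1.trans_le (hw.trans (hlt s).le), hx.2⟩
    have : x ∈ Set.range e := by rw [Finset.range_orderEmbOfFin]; exact hmem
    obtain ⟨i, rfl⟩ := this
    rw [Finset.mem_image]
    exact ⟨i, Finset.mem_Iio.2 (e.lt_iff_lt.1 (hx.1.trans_le hw)), rfl⟩
  calc _ ≤ ((Finset.Iio s).image e).card := Finset.card_le_card hsub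
    _ ≤ (Finset.Iio s).card := Finset.card_image_le
    _ = s := by simp

lemma finrank_le_tailCount_ncard {F : Type*} [Field F] [Fintype F] {r m : ℕ}
    {D : Submodule F ((Fin m → F) → F)} (hD : D ≤ qRM F r m) :
    Module.finrank F D ≤ tailCount (Fintype.card F) m ((Fintype.card F - 1) * m - r)
      (Finset.range { x | ∃ f ∈ D, f x ≠ 0 }.ncard) := by
  rw [Set.ncard_eq_toFinset_card _ (Set.toFinite _)]
  refine finrank_le_tailCount m _ r D (hD.trans (qRM_le_degLE F r m)) fun f hf x hx => ?_
  by_contra h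
  exact hx ((Set.Finite.mem_toFinset _).2 ⟨f, hf, h⟩)

lemma support_span_eq {F ι κ : Type*} [Field F] (s : Set κ) (c : κ → ι → F) :
    { x | ∃ f ∈ Submodule.span F (c '' s), f x ≠ 0 } = { x | ∃ i ∈ s, c i x ≠ 0 } := by
  ext x
  constructor
  · rintro ⟨f, hf, hfx⟩
    by_contra! h
    have hle : Submodule.span F (c '' s) ≤ LinearMap.ker (LinearMap.proj x : (ι → F) →ₗ[F] F) := by
      rw [Submodule.span_le]
      rintro _ ⟨i, hi, rfl⟩
      by_contra hne
      exact h ⟨i, hi, hne⟩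
    exact hfx (hle hf)
  · rintro ⟨i, hi, h⟩
    exact ⟨c i, Submodule.subset_span ⟨i, hi, rfl⟩, h⟩

/-- The `q`-ary Reed–Muller code `RM_q(r,m)` satisfies the chain condition: with `k` its
dimension, there exist `k` linearly independent codewords `c₁, …, c_k` such that
`|⋃_{i=1}^{s} supp(cᵢ)| = d_s(RM_q(r,m))` for every `s ∈ {1,…,k}`. -/
theorem stmt16 {F : Type*} [Field F] [Fintype F] {q r m k : ℕ}
    (hq : Fintype.card F = q) (hm : 1 ≤ m) (hr : r ≤ (q - 1) * m)
    (hk : Module.finrank F (qRM F r m) = k) :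
    ∃ c : Fin k → ((Fin m → F) → F),
      LinearIndependent F c ∧ (∀ i, c i ∈ qRM F r m) ∧
      ∀ s : Fin k, { x | ∃ i ≤ s, c i x ≠ 0 }.ncard = GHW F (qRM F r m) (s.1 + 1) := by
  obtain ⟨α, hinj, hsurj, -⟩ := exists_monotone_enum fun _ : F => 0
  rw [hq] at hinj hsurj
  have hq0 : 0 < q := hq ▸ Fintype.card_pos
  set t := (q - 1) * m - r with ht
  set K := (heavy q m t).card with hK
  let e : Fin K ↪o ℕ := (heavy q m t).orderEmbOfFin hK.symm
  have hmem : ∀ i, e i < q ^ m ∧ t ≤ digSum q m (e i) := fun i => by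
    have h := Finset.mem_filter.1 ((heavy q m t).orderEmbOfFin_mem hK.symm i)
    exact ⟨Finset.mem_range.1 h.1, h.2⟩
  let c : Fin K → (Fin m → F) → F := fun i => evalLM F m (digitPoly q m α (e i))
  have hc : ∀ i y, c i (digitPoint q m α y) ≠ 0 ↔ DigLE q m y (e i) := fun i y =>
    eval_digitPoly_ne_zero_iff hq0 hinj
  have hcmem : ∀ i, c i ∈ qRM F r m := fun i => evalLM_digitPoly_mem_qRM hq (hmem i).2
  have hind : LinearIndependent F c := by
    refine linearIndependent_of_triangular c (fun i => digitPoint q m α (e i))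
      (fun i => (hc i _).2 fun _ _ => le_rfl) fun i s his => ?_
    by_contra h
    exact (e.lt_iff_lt.2 his).not_ge (((hc i _).1 h).le (hmem i).1 (hmem s).1)
  have hkK : K = k := by
    refine le_antisymm ?_ ?_
    · have h1 : LinearIndependent F fun i => (⟨c i, hcmem i⟩ : qRM F r m) :=
        LinearIndependent.of_comp (qRM F r m).subtype hind
      simpa [hk] using h1.fintype_card_le_finrank
    · have h1 := finrank_le_tailCount m Finset.univ r _ (qRM_le_degLE F r m) (by simp)
      rw [hk, hq, Finset.card_univ, Fintype.card_fun, Fintype.card_fin, hq] at h1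
      exact h1
  clear_value K
  subst hkK
  refine ⟨c, hind, hcmem, fun s => ?_⟩
  have hspan : Module.finrank F (Submodule.span F (c '' Set.Iic s)) = s.1 + 1 := by
    rw [Set.image_eq_range]
    refine (finrank_span_eq_card (hind.comp _ Subtype.val_injective)).trans ?_
    rw [Fintype.card_of_finset' (Finset.Iic s) (by simp), Fin.card_Iic]
  have hspan_le : Submodule.span F (c '' Set.Iic s) ≤ qRM F r m := by
    rw [Submodule.span_le]
    rintro _ ⟨i, -, rfl⟩
    exact hcmem i
  have hle : { x | ∃ i ≤ s, c i x ≠ 0 }.ncard ≤ e s + 1 := by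
    have hsub : { x | ∃ i ≤ s, c i x ≠ 0 } ⊆
        ((Set.Iio (e s + 1)).image (digitPoint q m α)) := by
      rintro v ⟨i, his, hv⟩
      obtain ⟨y, hy, rfl⟩ := exists_digitPoint_eq hsurj v
      refine ⟨y, Set.mem_Iio.2 (Nat.lt_succ_of_le ?_), rfl⟩
      exact (((hc i y).1 hv).le (hmem i).1 hy).trans (e.le_iff_le.2 his)
    refine (Set.ncard_le_ncard hsub (Set.toFinite _)).trans ?_
    refine (Set.ncard_image_le (Set.finite_Iio _)).trans ?_
    simp [Set.ncard_eq_toFinset_card']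
  have hwit : { x | ∃ i ≤ s, c i x ≠ 0 }.ncard ∈ { w | ∃ D : Submodule F ((Fin m → F) → F),
      D ≤ qRM F r m ∧ Module.finrank F D = s.1 + 1 ∧ { i | ∃ x ∈ D, x i ≠ 0 }.ncard = w } :=
    ⟨_, hspan_le, hspan, by rw [support_span_eq]; rfl⟩
  refine le_antisymm (hle.trans ?_) (Nat.sInf_le hwit)
  obtain ⟨D, hD, hDs, hDw⟩ := Nat.sInf_mem ⟨_, hwit⟩
  rw [GHW, ← hDw]
  by_contra! hlt
  have h1 := finrank_le_tailCount_ncard hD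
  rw [hDs, hq] at h1
  exact (Nat.lt_succ_self _).not_ge
    (h1.trans (tailCount_range_le_of_le_orderEmbOfFin hK.symm s (Nat.le_of_lt_succ hlt)))
end
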